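/- Let n ≥ 1 be a natural number and x a real number. Then 2^{δ(n-1)} · (∏_{j=1}^{⌊n/2⌋}(n - j)) · T_n(x) = x^{δ(n)} · Ω_0(⌊n/2⌋ | 1, 2 - 4x² | n), where T_n denotes the n-th Chebyshev polynomial of the first kind (defined by T_0(x) = 1, T_1(x) = x, T_{n+1}(x) = 2x·T_n(x) - T_{n-1}(x)) evaluated at x. -/

import Mathlib

/-- The Omega sequence `Ω_r(k | ζ, ξ | n)` with real parameters: `Ω_r(0) = 1` and
`Ω_r(k+1) = (2ζ-ξ)(n-r-(k+1))·Ω_r(k) - 2ζ(n-2r-δ(n-1))·Ω_{r+1}(k)`. -/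
def omegaR (ζ ξ : ℝ) (n : ℕ) : ℕ → ℕ → ℝ
  | _, 0 => 1
  | r, k + 1 =>
    (2 * ζ - ξ) * ((n : ℝ) - r - (k + 1)) * omegaR ζ ξ n r k
      - 2 * ζ * ((n : ℝ) - 2 * r - ((n - 1) % 2 : ℕ)) * omegaR ζ ξ n (r + 1) k

/-- The Chebyshev polynomials of the first kind (as functions on ℝ):
`T 0 x = 1`, `T 1 x = x`, `T (n+2) x = 2x·T (n+1) x - T n x`. -/
def chebT : ℕ → ℝ → ℝ
  | 0, _ => 1
  | 1, x => x
  | n + 2, x => 2 * x * chebT (n + 1) x - chebT n x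

/-- The coefficients of `(1 - y t) ^ (-s) * (1 - 4 t) ^ (c / 4) = ∑ k, omegaAux y k s c * t ^ k / k!`,
defined through the recurrence given by differentiation in `t`. -/
def omegaAux (y : ℝ) : ℕ → ℝ → ℝ → ℝ
  | 0, _, _ => 1
  | k + 1, s, c => y * s * omegaAux y k (s + 1) c - c * omegaAux y k s (c - 4)

lemma omegaAux_succ (y : ℝ) (k : ℕ) (s c : ℝ) :
    omegaAux y (k + 1) s c = y * s * omegaAux y k (s + 1) c - c * omegaAux y k s (c - 4) := rfl

lemma omegaR_one_eq_omegaAux (ξ : ℝ) (n r k : ℕ) :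
    omegaR 1 ξ n r k =
      omegaAux (2 - ξ) k ((n : ℝ) - r - k) (2 * ((n : ℝ) - 2 * r - ((n - 1) % 2 : ℕ))) := by
  induction k generalizing r with
  | zero => simp [omegaR, omegaAux]
  | succ k ih =>
    rw [omegaR, ih, ih, omegaAux_succ]
    push_cast
    ring_nf

lemma omegaAux_succ_eq_sub_shift_left (y : ℝ) (k : ℕ) (s c : ℝ) :
    omegaAux y (k + 1) s c =
      omegaAux y (k + 1) (s + 1) c - y * (k + 1) * omegaAux y k (s + 1) c := by
  induction k generalizing s c with
  | zero => simp only [omegaAux]; push_cast; ring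
  | succ k ih =>
    have hD := omegaAux_succ y k (s + 1) c
    rw [omegaAux_succ y (k + 1) s c, omegaAux_succ y (k + 1) (s + 1) c]
    push_cast
    linear_combination y * (s + 1) * ih (s + 1) c - c * ih s (c - 4) + y * (k + 1) * hD

lemma omegaAux_succ_add_four (y : ℝ) (k : ℕ) (s c : ℝ) :
    omegaAux y (k + 1) s (c + 4) = omegaAux y (k + 1) s c - 4 * (k + 1) * omegaAux y k s c := by
  induction k generalizing s c with
  | zero => simp only [omegaAux]; push_cast; ring
  | succ k ih =>
    have hD := omegaAux_succ y k s c
    have hB := ih s (c - 4)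
    rw [sub_add_cancel] at hB
    rw [omegaAux_succ y (k + 1) s (c + 4), omegaAux_succ y (k + 1) s c, add_sub_cancel_right]
    push_cast
    linear_combination y * s * ih (s + 1) c - c * hB + 4 * (k + 1) * hD

/-- Contiguous relation behind `T_{2m+2} = 2x T_{2m+1} - T_{2m}`. -/
lemma omegaAux_even_step (y : ℝ) (m : ℕ) :
    omegaAux y (m + 1) (m + 1) (4 * m + 2) =
      (4 * m + 2) * (y / 2 * omegaAux y m (m + 1) (4 * m + 2) - omegaAux y m m (4 * m - 2)) := by
  cases m with
  | zero => simp only [omegaAux]; push_cast; ring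
  | succ k =>
    have hD := omegaAux_succ y (k + 1) (k + 2) (4 * k + 6)
    have hA := omegaAux_succ_eq_sub_shift_left y k (k + 1) (4 * k + 2)
    have hD' := omegaAux_succ y k (k + 2) (4 * k + 6)
    have hA' := omegaAux_succ_eq_sub_shift_left y k (k + 2) (4 * k + 6)
    push_cast
    ring_nf at hD hA hD' hA' ⊢
    linear_combination hD + (4 * k + 6) * hA - y * (k + 1) * hD' - y * (k + 2) * hA'

lemma omegaAux_shift_left_eq (y : ℝ) (k : ℕ) :
    2 * (k + 1) * omegaAux y k (k + 2) (4 * k + 2) =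
      (2 * k + 1) * (omegaAux y k (k + 1) (4 * k - 2) + omegaAux y k (k + 1) (4 * k + 2)) := by
  cases k with
  | zero => simp only [omegaAux]; push_cast; ring
  | succ k =>
    have hD := omegaAux_succ y k (k + 2) (4 * k + 6)
    have hA := omegaAux_succ_eq_sub_shift_left y k (k + 2) (4 * k + 6)
    have hB := omegaAux_succ_add_four y k (k + 2) (4 * k + 2)
    push_cast
    ring_nf at hD hA hB ⊢
    linear_combination -2 * (k + 1) * hD - 2 * (k + 2) * hA + (2 * k + 3) * hB

/-- Contiguous relation behind `T_{2m+3} = 2x T_{2m+2} - T_{2m+1}`. -/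
lemma omegaAux_odd_step (y : ℝ) (m : ℕ) :
    omegaAux y (m + 1) (m + 2) (4 * m + 6) =
      2 * omegaAux y (m + 1) (m + 1) (4 * m + 2)
        - (4 * m + 2) * omegaAux y m (m + 1) (4 * m + 2) := by
  have hB := omegaAux_succ_add_four y m (m + 2) (4 * m + 2)
  have hA := omegaAux_succ_eq_sub_shift_left y m (m + 1) (4 * m + 2)
  have hD := omegaAux_succ y m (m + 1) (4 * m + 2)
  have hS := omegaAux_shift_left_eq y m
  ring_nf at hB hA hD hS ⊢
  linear_combination hB - hA - hD - 2 * hS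

lemma prod_Icc_sub_eq_prod_range (a : ℝ) (m : ℕ) :
    ∏ j ∈ Finset.Icc 1 m, (a - j) = ∏ i ∈ Finset.range m, (a - 1 - i) := by
  induction m with
  | zero => simp
  | succ m ih =>
    rw [Finset.prod_Icc_succ_top (Nat.le_add_left 1 m), ih, Finset.prod_range_succ]
    push_cast
    ring

lemma prod_range_two_mul_add_one_sub (m : ℕ) :
    ∏ i ∈ Finset.range (m + 1), (2 * (m : ℝ) + 1 - i) =
      (2 * m + 1) * ∏ i ∈ Finset.range m, (2 * (m : ℝ) - i) := by
  rw [Finset.prod_range_succ', mul_comm]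
  push_cast
  congr 1
  · ring
  · exact Finset.prod_congr rfl fun i _ => by ring

lemma prod_range_two_mul_succ_sub (m : ℕ) :
    ∏ i ∈ Finset.range (m + 1), (2 * ((m + 1 : ℕ) : ℝ) - i) =
      (4 * m + 2) * ∏ i ∈ Finset.range m, (2 * (m : ℝ) - i) := by
  have h := prod_range_two_mul_add_one_sub m
  rw [Finset.prod_range_succ] at h
  rw [Finset.prod_range_succ']
  have hc : ∏ i ∈ Finset.range m, (2 * ((m + 1 : ℕ) : ℝ) - ((i + 1 : ℕ) : ℝ)) =
      ∏ i ∈ Finset.range m, (2 * (m : ℝ) + 1 - i) :=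
    Finset.prod_congr rfl fun i _ => by push_cast; ring
  rw [hc]
  push_cast
  linear_combination 2 * h

lemma prod_range_mul_chebT (x : ℝ) (m : ℕ) :
    (∏ i ∈ Finset.range m, (2 * (m : ℝ) - i)) * chebT (2 * m) x =
        omegaAux (4 * x ^ 2) m m (4 * m - 2) ∧
      (∏ i ∈ Finset.range m, (2 * (m : ℝ) - i)) * chebT (2 * m + 1) x =
        x * omegaAux (4 * x ^ 2) m (m + 1) (4 * m + 2) := by
  induction m with
  | zero => simp [chebT, omegaAux]
  | succ m ih =>
    obtain ⟨hE, hO⟩ := ih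
    have hE' := omegaAux_even_step (4 * x ^ 2) m
    have hO' := omegaAux_odd_step (4 * x ^ 2) m
    have hT : chebT (2 * (m + 1)) x = 2 * x * chebT (2 * m + 1) x - chebT (2 * m) x := rfl
    have hT' : chebT (2 * (m + 1) + 1) x =
      2 * x * chebT (2 * (m + 1)) x - chebT (2 * m + 1) x := rfl
    have c₁ : (4 * ((m : ℝ) + 1) - 2) = 4 * m + 2 := by ring
    have c₂ : (4 * ((m : ℝ) + 1) + 2) = 4 * m + 6 := by ring
    have c₃ : (m : ℝ) + 1 + 1 = m + 2 := by ring
    rw [prod_range_two_mul_succ_sub, hT', hT]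
    push_cast
    rw [c₁, c₂, c₃, hO', hE']
    constructor
    · linear_combination (4 * m + 2) * (2 * x * hO - hE)
    · linear_combination (4 * m + 2) * (2 * x * (2 * x * hO - hE) - hO)

theorem omega_chebyshev_representation
    (n : ℕ) (hn : 1 ≤ n) (x : ℝ) :
    2 ^ ((n - 1) % 2) * (∏ j ∈ Finset.Icc 1 (n / 2), ((n : ℝ) - j)) * chebT n x =
      x ^ (n % 2) * omegaR 1 (2 - 4 * x ^ 2) n 0 (n / 2) := by
  rw [omegaR_one_eq_omegaAux, sub_sub_cancel, prod_Icc_sub_eq_prod_range]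
  obtain ⟨m, rfl | rfl⟩ := Nat.even_or_odd' n
  · obtain ⟨k, rfl⟩ : ∃ k, m = k + 1 := ⟨m - 1, by omega⟩
    have h := (prod_range_mul_chebT x (k + 1)).1
    rw [prod_range_two_mul_succ_sub] at h
    have h₁ : (2 * (k + 1) - 1) % 2 = 1 := by omega
    have h₂ : 2 * (k + 1) / 2 = k + 1 := by omega
    have h₃ : 2 * (k + 1) % 2 = 0 := by omega
    have c₁ : ((2 * (k + 1) : ℕ) : ℝ) - 1 = 2 * k + 1 := by push_cast; ring
    have c₂ : ((2 * (k + 1) : ℕ) : ℝ) - (0 : ℕ) - (k + 1 : ℕ) = (k + 1 : ℕ) := by push_cast; ring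
    have c₃ : 2 * (((2 * (k + 1) : ℕ) : ℝ) - 2 * (0 : ℕ) - (1 : ℕ)) = 4 * (k + 1 : ℕ) - 2 := by
      push_cast; ring
    rw [h₁, h₂, h₃, c₁, c₂, c₃, prod_range_two_mul_add_one_sub, ← h]
    ring
  · have h := (prod_range_mul_chebT x m).2
    have h₁ : (2 * m + 1 - 1) % 2 = 0 := by omega
    have h₂ : (2 * m + 1) / 2 = m := by omega
    have h₃ : (2 * m + 1) % 2 = 1 := by omega
    have c₁ : ((2 * m + 1 : ℕ) : ℝ) - 1 = 2 * m := by push_cast; ring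
    have c₂ : ((2 * m + 1 : ℕ) : ℝ) - (0 : ℕ) - m = m + 1 := by push_cast; ring
    have c₃ : 2 * (((2 * m + 1 : ℕ) : ℝ) - 2 * (0 : ℕ) - (0 : ℕ)) = 4 * m + 2 := by
      push_cast; ring
    rw [h₁, h₂, h₃, c₁, c₂, c₃, pow_one, ← h]
    ring
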